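/- Let k ≥ 0 and let B_1, …, B_{k+1} be real matrices with B_i of size m_{i−1} × m_i, satisfying B_i B_{i+1} = 0 for all i = 1, …, k, and set B_0 to be the (unique) linear map from ℝ^{m_0} to the zero space (so B_0ᵀB_0 = 0). Define the Betti numbers β_i = dim ker(B_iᵀB_i + B_{i+1}B_{i+1}ᵀ) for i = 0, …, k. Then rank(B_{k+1}) = Σ_{i=0}^{k} (−1)^{k−i} (m_i − β_i). In particular, the ℓ¹-norm of the generalized effective resistance vector of the weighted boundary B_{k+1}W_{k+1} with W_{k+1} diagonal invertible equals this alternating sum, since ‖r‖₁ = rank(B_{k+1}). -/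

import Mathlib

open Matrix

/-- The kernel of `AᵀA + BBᵀ` is the intersection of the kernels of `A` and `Bᵀ`. -/
theorem ker_hodgeLaplacian {l m n : Type*} [Fintype l] [Fintype m] [Fintype n]
    (A : Matrix l m ℝ) (B : Matrix m n ℝ) :
    LinearMap.ker (Aᵀ * A + B * Bᵀ).mulVecLin =
      LinearMap.ker A.mulVecLin ⊓ LinearMap.ker Bᵀ.mulVecLin := by
  ext x
  simp only [Submodule.mem_inf, LinearMap.mem_ker, mulVecLin_apply]
  constructor
  · intro h
    have hsum : (A *ᵥ x) ⬝ᵥ (A *ᵥ x) + (Bᵀ *ᵥ x) ⬝ᵥ (Bᵀ *ᵥ x) = 0 := by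
      have h' : x ⬝ᵥ ((Aᵀ * A + B * Bᵀ) *ᵥ x) = 0 := by rw [h, dotProduct_zero]
      rwa [add_mulVec, dotProduct_add, ← mulVec_mulVec, ← mulVec_mulVec, dotProduct_mulVec,
        dotProduct_mulVec x B, vecMul_transpose, ← mulVec_transpose B] at h'
    have hA : 0 ≤ (A *ᵥ x) ⬝ᵥ (A *ᵥ x) := Finset.sum_nonneg fun i _ => mul_self_nonneg _
    have hB : 0 ≤ (Bᵀ *ᵥ x) ⬝ᵥ (Bᵀ *ᵥ x) := Finset.sum_nonneg fun i _ => mul_self_nonneg _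
    exact ⟨dotProduct_self_eq_zero.mp (by linarith), dotProduct_self_eq_zero.mp (by linarith)⟩
  · rintro ⟨hA, hB⟩
    rw [add_mulVec, ← mulVec_mulVec, ← mulVec_mulVec, hA, hB, mulVec_zero, mulVec_zero, add_zero]

/-- Dimension count in the Hodge decomposition of a two-step complex. -/
theorem finrank_ker_hodgeLaplacian {l m n : Type*} [Fintype l] [Fintype m] [Fintype n]
    (A : Matrix l m ℝ) (B : Matrix m n ℝ) (hAB : A * B = 0) :
    A.rank + B.rank + Module.finrank ℝ (LinearMap.ker (Aᵀ * A + B * Bᵀ).mulVecLin) =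
      Fintype.card m := by
  let f := Bᵀ.mulVecLin.domRestrict (LinearMap.ker A.mulVecLin)
  have hker : Module.finrank ℝ (LinearMap.ker f) =
      Module.finrank ℝ (LinearMap.ker (Aᵀ * A + B * Bᵀ).mulVecLin) := by
    rw [ker_hodgeLaplacian, ← Submodule.map_comap_subtype, Submodule.finrank_map_subtype_eq,
      LinearMap.ker_domRestrict]
  have hrange : Module.finrank ℝ (LinearMap.range f) = B.rank := by
    apply le_antisymm
    · rw [← rank_transpose]
      apply Submodule.finrank_mono
      rintro _ ⟨x, rfl⟩
      exact ⟨x, rfl⟩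
    · rw [← rank_transpose_mul_self]
      apply Submodule.finrank_mono
      rintro _ ⟨x, rfl⟩
      refine ⟨⟨B *ᵥ x, ?_⟩, ?_⟩
      · simp [hAB]
      · simp [f]
  have hf := f.finrank_range_add_finrank_ker
  have hA := A.mulVecLin.finrank_range_add_finrank_ker
  rw [Module.finrank_fintype_fun_eq_card] at hA
  rw [hker, hrange] at hf
  change A.rank + _ = _ at hA
  omega

/-- Right multiplication by an invertible diagonal matrix preserves the rank. -/
theorem rank_mul_diagonal {m n : Type*} [Fintype m] [Fintype n] [DecidableEq n]
    (A : Matrix m n ℝ) (w : n → ℝ) (hw : ∀ j, w j ≠ 0) :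
    (A * diagonal w).rank = A.rank := by
  apply rank_mul_eq_left_of_isUnit_det
  rw [det_diagonal]
  exact (Finset.prod_ne_zero_iff.mpr fun j _ => hw j).isUnit

/-- **Rank of the top boundary map as an alternating sum (Euler-type formula).**
Here `Bd i` plays the role of the paper's boundary matrix `B_{i+1} : ℝ^{m_i × m_{i+1}}`,
so `Bd i * Bd (i+1) = 0` encodes `B_{i+1} B_{i+2} = 0`, and the Betti numbers are
`β 0 = dim ker(B₁B₁ᵀ)` (since `B₀ᵀB₀ = 0`) and
`β (i+1) = dim ker(B_{i+1}ᵀB_{i+1} + B_{i+2}B_{i+2}ᵀ)`.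
Then `rank(B_{k+1}) = ∑_{i=0}^{k} (−1)^{k−i} (m_i − β_i)`; in particular the same holds for
the weighted boundary `B_{k+1} W_{k+1}` with `W_{k+1}` diagonal invertible, whose rank equals
the ℓ¹-norm of its generalized effective resistance vector. -/
theorem stmt_11 (k : ℕ) (m : ℕ → ℕ)
    (Bd : (i : ℕ) → Matrix (Fin (m i)) (Fin (m (i + 1))) ℝ)
    (hchain : ∀ i, i + 1 ≤ k → Bd i * Bd (i + 1) = 0)
    (β : ℕ → ℕ)
    (hβ0 : β 0 = Module.finrank ℝ (LinearMap.ker (Bd 0 * (Bd 0)ᵀ).mulVecLin))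
    (hβ : ∀ i, i + 1 ≤ k →
      β (i + 1) = Module.finrank ℝ
        (LinearMap.ker ((Bd i)ᵀ * Bd i + Bd (i + 1) * (Bd (i + 1))ᵀ).mulVecLin)) :
    (((Bd k).rank : ℤ)
        = ∑ i ∈ Finset.range (k + 1), (-1 : ℤ) ^ (k - i) * ((m i : ℤ) - (β i : ℤ))) ∧
    ∀ w : Fin (m (k + 1)) → ℝ, (∀ j, w j ≠ 0) →
      (((Bd k * Matrix.diagonal w).rank : ℤ)
        = ∑ i ∈ Finset.range (k + 1), (-1 : ℤ) ^ (k - i) * ((m i : ℤ) - (β i : ℤ))) := by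
  have hrank : ∀ j, j ≤ k → ((Bd j).rank : ℤ) =
      ∑ i ∈ Finset.range (j + 1), (-1 : ℤ) ^ (j - i) * ((m i : ℤ) - (β i : ℤ)) := by
    intro j
    induction j with
    | zero =>
      intro _
      have h := (Bd 0 * (Bd 0)ᵀ).mulVecLin.finrank_range_add_finrank_ker
      rw [← hβ0, Module.finrank_fin_fun] at h
      change (Bd 0 * (Bd 0)ᵀ).rank + _ = _ at h
      rw [rank_self_mul_transpose] at h
      simp only [zero_add, Finset.sum_range_one, Nat.sub_self, pow_zero, one_mul]
      omega
    | succ j ih =>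
      intro hj
      have h := finrank_ker_hodgeLaplacian (Bd j) (Bd (j + 1)) (hchain j hj)
      rw [← hβ j hj, Fintype.card_fin] at h
      have hneg : ∑ i ∈ Finset.range (j + 1),
          (-1 : ℤ) ^ (j + 1 - i) * ((m i : ℤ) - (β i : ℤ)) = -((Bd j).rank : ℤ) := by
        rw [ih (by omega), ← Finset.sum_neg_distrib]
        refine Finset.sum_congr rfl fun i hi => ?_
        rw [Nat.sub_add_comm (Finset.mem_range_succ_iff.mp hi), pow_succ]
        ring
      rw [Finset.sum_range_succ, hneg, Nat.sub_self, pow_zero, one_mul]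
      omega
  refine ⟨hrank k le_rfl, fun w hw => ?_⟩
  rw [rank_mul_diagonal _ _ hw]
  exact hrank k le_rfl
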